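/- arXiv:1601.00944 — 2 statements merged into one kernel-verified Lean document; each statement's English description precedes it below -/
import Mathlib

section
/- Let B be a rooted tree, and let T be the rooted tree obtained by taking a new root r and attaching two disjoint copies of B to r (the root of each copy of B made adjacent to r). Then nr(T) ≤ (nr(B) + 1)(nr(B) + 2)/2. -/
open SimpleGraph

/-- The type of subtrees of a graph `G`: vertex subsets inducing a connected
(hence nonempty) subgraph. -/
def GraphSubtree {V : Type*} (G : SimpleGraph V) : Type _ :=
  {S : Set V // (G.induce S).Connected}

/-- Two subtrees are isomorphic if their induced subgraphs are isomorphic as graphs. -/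
def SubtreeIso {V : Type*} (G : SimpleGraph V) (S T : GraphSubtree G) : Prop :=
  Nonempty (G.induce S.1 ≃g G.induce T.1)

/-- `ns G`: the number of isomorphism classes of subtrees of `G`. -/
noncomputable def ns {V : Type*} (G : SimpleGraph V) : ℕ :=
  Nat.card (Quot (SubtreeIso G))

/-- Subtrees of `G` containing the root `r`. -/
def RootedSubtree {V : Type*} (G : SimpleGraph V) (r : V) : Type _ :=
  {S : Set V // r ∈ S ∧ (G.induce S).Connected}

/-- Root-preserving isomorphism of rooted subtrees. -/
def RootedSubtreeIso {V : Type*} (G : SimpleGraph V) (r : V)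
    (S T : RootedSubtree G r) : Prop :=
  ∃ f : G.induce S.1 ≃g G.induce T.1, f ⟨r, S.2.1⟩ = ⟨r, T.2.1⟩

/-- `nr G r`: the number of root-preserving isomorphism classes of subtrees
of `G` containing `r`. -/
noncomputable def nr {V : Type*} (G : SimpleGraph V) (r : V) : ℕ :=
  Nat.card (Quot (RootedSubtreeIso G r))

/-- `maxNS n` (written `S_n` in the paper): the maximum of `ns T` over all
trees `T` with `n` vertices. -/
noncomputable def maxNS (n : ℕ) : ℕ :=
  sSup {k | ∃ G : SimpleGraph (Fin n), G.IsTree ∧ ns G = k}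

/-- `maxNR n` (written `R_n` in the paper): the maximum of `nr T` over all
rooted trees `T` with `n` vertices. -/
noncomputable def maxNR (n : ℕ) : ℕ :=
  sSup {k | ∃ (G : SimpleGraph (Fin n)) (r : Fin n), G.IsTree ∧ nr G r = k}

/-- The rooted tree obtained from a rooted tree `(H, s)` by taking a new root and
attaching two disjoint copies of `H`, the root of each copy made adjacent to the
new root. -/
def attachTwoCopies {W : Type*} (H : SimpleGraph W) (s : W) :
    SimpleGraph (Unit ⊕ W ⊕ W) :=
  SimpleGraph.fromRel fun x y =>
    (x = Sum.inl () ∧ (y = Sum.inr (Sum.inl s) ∨ y = Sum.inr (Sum.inr s))) ∨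
    (∃ a b, H.Adj a b ∧ x = Sum.inr (Sum.inl a) ∧ y = Sum.inr (Sum.inl b)) ∨
    (∃ a b, H.Adj a b ∧ x = Sum.inr (Sum.inr a) ∧ y = Sum.inr (Sum.inr b))

theorem RootedSubtreeIso.equivalence {V : Type*} (G : SimpleGraph V) (r : V) :
    Equivalence (RootedSubtreeIso G r) where
  refl _ := ⟨SimpleGraph.Iso.refl, rfl⟩
  symm := by
    rintro S T ⟨f, hf⟩
    exact ⟨f.symm, by rw [← hf]; exact f.symm_apply_apply _⟩
  trans := by
    rintro S T U ⟨f, hf⟩ ⟨g, hg⟩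
    exact ⟨g.comp f, by rw [← hg, ← hf]; rfl⟩

/-- `f` restricts to an isomorphism between the subgraphs of `G` induced on `A` and `B`,
and on `A` it takes the value `r` exactly at `r`. -/
def IsRootedIsoOn {V : Type*} (G : SimpleGraph V) (r : V) (f : V → V) (A B : Set V) : Prop :=
  Set.BijOn f A B ∧ (∀ a ∈ A, ∀ b ∈ A, G.Adj (f a) (f b) ↔ G.Adj a b) ∧
    ∀ a ∈ A, f a = r ↔ a = r

theorem rootedSubtreeIso_of_isRootedIsoOn {V : Type*} {G : SimpleGraph V} {r : V}
    {S T : RootedSubtree G r} {f : V → V} (h : IsRootedIsoOn G r f S.1 T.1) :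
    RootedSubtreeIso G r S T :=
  ⟨⟨h.1.equiv f, fun {a b} => h.2.1 a a.2 b b.2⟩, Subtype.ext ((h.2.2 r S.2.1).2 rfl)⟩

theorem RootedSubtreeIso.exists_isRootedIsoOn {V : Type*} {G : SimpleGraph V} {r : V}
    {S T : RootedSubtree G r} (h : RootedSubtreeIso G r S T) :
    ∃ f, IsRootedIsoOn G r f S.1 T.1 := by
  classical
  obtain ⟨f, hf⟩ := h
  have key : ∀ (a : V) (ha : a ∈ S.1),
      (if h : a ∈ S.1 then (f ⟨a, h⟩ : V) else a) = f ⟨a, ha⟩ := fun a ha => dif_pos ha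
  refine ⟨fun a => if h : a ∈ S.1 then (f ⟨a, h⟩ : V) else a, ⟨?_, ?_, ?_⟩, ?_, ?_⟩
  · intro a ha
    simp only [key a ha]
    exact (f ⟨a, ha⟩).2
  · intro a ha b hb hab
    simp only [key a ha, key b hb] at hab
    simpa using f.injective (Subtype.ext hab)
  · intro b hb
    refine ⟨f.symm ⟨b, hb⟩, (f.symm ⟨b, hb⟩).2, ?_⟩
    simp only [key _ (f.symm ⟨b, hb⟩).2]
    simp
  · intro a ha b hb
    simp only [key a ha, key b hb]
    exact f.map_rel_iff (a := ⟨a, ha⟩) (b := ⟨b, hb⟩)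
  · intro a ha
    simp only [key a ha]
    constructor
    · intro h
      have : f ⟨a, ha⟩ = f ⟨r, S.2.1⟩ := by rw [hf]; exact Subtype.ext h
      simpa using f.injective this
    · rintro rfl
      rw [hf]

/-- If `G` contains a copy of `H` which is joined to the rest of `G` only through `s`, then a
subtree containing a vertex outside the copy meets the copy in vertices joined to `s`. -/
theorem reachable_preimage_of_connected {V W : Type*} {G : SimpleGraph V} {H : SimpleGraph W}
    {r : V} {s : W} (i : H ↪g G) (hr : ∀ w, i w ≠ r)
    (hi : ∀ x w, G.Adj x (i w) → (∃ a, x = i a) ∨ w = s) (S : RootedSubtree G r)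
    (w : W) (hw : i w ∈ S.1) :
    ∃ hs : s ∈ i ⁻¹' S.1, (H.induce (i ⁻¹' S.1)).Reachable ⟨s, hs⟩ ⟨w, hw⟩ := by
  have hreach := (G.induce S.1).reachable_iff_reflTransGen _ _ |>.1
    (S.2.2.preconnected ⟨r, S.2.1⟩ ⟨i w, hw⟩)
  generalize hx : (⟨i w, hw⟩ : S.1) = x at hreach
  induction hreach generalizing w with
  | refl => exact absurd (congrArg Subtype.val hx) (hr w)
  | @tail y z _ hadj ih =>
    subst hx
    have hadj' : G.Adj y.1 (i w) := hadj
    rcases hi _ _ hadj' with ⟨a, ha⟩ | rfl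
    · have haS : i a ∈ S.1 := ha ▸ y.2
      obtain ⟨hs, h⟩ := ih a haS (Subtype.ext ha.symm)
      refine ⟨hs, h.trans (SimpleGraph.Adj.reachable ?_)⟩
      rw [ha] at hadj'
      exact i.map_adj_iff.1 hadj'
    · exact ⟨hw, SimpleGraph.Reachable.refl _⟩

open Classical in
/-- The isomorphism class of the rooted subtree of `H` with vertex set `A`, or `none` if `A` is
not the vertex set of a subtree containing `s`. -/
noncomputable def branchClass {W : Type*} (H : SimpleGraph W) (s : W) (A : Set W) :
    Option (Quot (RootedSubtreeIso H s)) :=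
  if h : s ∈ A ∧ (H.induce A).Connected then some (Quot.mk _ ⟨A, h⟩) else none

/-- `A` is empty or the vertex set of a subtree containing `s`. -/
def IsBranch {W : Type*} (H : SimpleGraph W) (s : W) (A : Set W) : Prop :=
  A = ∅ ∨ s ∈ A ∧ (H.induce A).Connected

theorem isBranch_preimage {V W : Type*} {G : SimpleGraph V} {H : SimpleGraph W}
    {r : V} {s : W} (i : H ↪g G) (hr : ∀ w, i w ≠ r)
    (hi : ∀ x w, G.Adj x (i w) → (∃ a, x = i a) ∨ w = s) (S : RootedSubtree G r) :
    IsBranch H s (i ⁻¹' S.1) := by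
  rcases Set.eq_empty_or_nonempty (i ⁻¹' S.1) with h | ⟨w, hw⟩
  · exact Or.inl h
  · obtain ⟨hs, -⟩ := reachable_preimage_of_connected i hr hi S w hw
    refine Or.inr ⟨hs, (SimpleGraph.connected_iff_exists_forall_reachable _).2 ⟨⟨s, hs⟩, ?_⟩⟩
    rintro ⟨v, hv⟩
    exact (reachable_preimage_of_connected i hr hi S v hv).2

theorem exists_isRootedIsoOn_of_branchClass_eq {W : Type*} {H : SimpleGraph W} {s : W}
    {A B : Set W} (hA : IsBranch H s A) (hB : IsBranch H s B)
    (h : branchClass H s A = branchClass H s B) : ∃ f, IsRootedIsoOn H s f A B := by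
  unfold branchClass at h
  rcases hA with rfl | hA <;> rcases hB with rfl | hB
  · exact ⟨id, Set.bijOn_id _, by simp, by simp⟩
  · simp [hB] at h
  · simp [hA] at h
  · rw [dif_pos hA, dif_pos hB, Option.some_inj] at h
    have := (RootedSubtreeIso.equivalence H s).eqvGen_iff.1 (Quot.eqvGen_exact h)
    exact this.exists_isRootedIsoOn

section attachTwoCopies

variable {W : Type*} (H : SimpleGraph W) (s : W)

@[simp] theorem attachTwoCopies_adj_left_left (a b : W) :
    (attachTwoCopies H s).Adj (Sum.inr (Sum.inl a)) (Sum.inr (Sum.inl b)) ↔ H.Adj a b := by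
  simp only [attachTwoCopies, SimpleGraph.fromRel_adj]
  simpa [H.adj_comm b a] using fun h : H.Adj a b => h.ne

@[simp] theorem attachTwoCopies_adj_right_right (a b : W) :
    (attachTwoCopies H s).Adj (Sum.inr (Sum.inr a)) (Sum.inr (Sum.inr b)) ↔ H.Adj a b := by
  simp only [attachTwoCopies, SimpleGraph.fromRel_adj]
  simpa [H.adj_comm b a] using fun h : H.Adj a b => h.ne

/-- The first copy of `H` in `attachTwoCopies H s`. -/
def attachTwoCopiesLeft : H ↪g attachTwoCopies H s where
  toFun w := Sum.inr (Sum.inl w)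
  inj' _ _ h := by simpa using h
  map_rel_iff' {a b} := attachTwoCopies_adj_left_left H s a b

/-- The second copy of `H` in `attachTwoCopies H s`. -/
def attachTwoCopiesRight : H ↪g attachTwoCopies H s where
  toFun w := Sum.inr (Sum.inr w)
  inj' _ _ h := by simpa using h
  map_rel_iff' {a b} := attachTwoCopies_adj_right_right H s a b

@[simp] theorem attachTwoCopies_adj_left_right (a b : W) :
    ¬(attachTwoCopies H s).Adj (Sum.inr (Sum.inl a)) (Sum.inr (Sum.inr b)) := by
  simp [attachTwoCopies]

@[simp] theorem attachTwoCopies_adj_right_left (a b : W) :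
    ¬(attachTwoCopies H s).Adj (Sum.inr (Sum.inr a)) (Sum.inr (Sum.inl b)) := by
  simp [attachTwoCopies]

@[simp] theorem attachTwoCopies_adj_root_left (u : Unit) (b : W) :
    (attachTwoCopies H s).Adj (Sum.inl u) (Sum.inr (Sum.inl b)) ↔ b = s := by
  simp [attachTwoCopies]

@[simp] theorem attachTwoCopies_adj_root_right (u : Unit) (b : W) :
    (attachTwoCopies H s).Adj (Sum.inl u) (Sum.inr (Sum.inr b)) ↔ b = s := by
  simp [attachTwoCopies]

@[simp] theorem attachTwoCopies_adj_left_root (u : Unit) (b : W) :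
    (attachTwoCopies H s).Adj (Sum.inr (Sum.inl b)) (Sum.inl u) ↔ b = s := by
  simp [attachTwoCopies]

@[simp] theorem attachTwoCopies_adj_right_root (u : Unit) (b : W) :
    (attachTwoCopies H s).Adj (Sum.inr (Sum.inr b)) (Sum.inl u) ↔ b = s := by
  simp [attachTwoCopies]

variable {H s}

theorem isBranch_left (S : RootedSubtree (attachTwoCopies H s) (Sum.inl ())) :
    IsBranch H s ((fun w => Sum.inr (Sum.inl w)) ⁻¹' S.1) := by
  refine isBranch_preimage (attachTwoCopiesLeft H s) (fun w => Sum.inr_ne_inl) ?_ S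
  rintro (u | a | a) w h
  · exact Or.inr ((attachTwoCopies_adj_root_left H s u w).1 h)
  · exact Or.inl ⟨a, rfl⟩
  · exact absurd h (attachTwoCopies_adj_right_left H s a w)

theorem isBranch_right (S : RootedSubtree (attachTwoCopies H s) (Sum.inl ())) :
    IsBranch H s ((fun w => Sum.inr (Sum.inr w)) ⁻¹' S.1) := by
  refine isBranch_preimage (attachTwoCopiesRight H s) (fun w => Sum.inr_ne_inl) ?_ S
  rintro (u | a | a) w h
  · exact Or.inr ((attachTwoCopies_adj_root_right H s u w).1 h)
  · exact absurd h (attachTwoCopies_adj_left_right H s a w)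
  · exact Or.inl ⟨a, rfl⟩

theorem isRootedIsoOn_attachTwoCopies {S T : Set (Unit ⊕ W ⊕ W)} (hS : Sum.inl () ∈ S)
    (hT : Sum.inl () ∈ T) {f g : W → W}
    (hf : IsRootedIsoOn H s f ((fun w => Sum.inr (Sum.inl w)) ⁻¹' S)
      ((fun w => Sum.inr (Sum.inl w)) ⁻¹' T))
    (hg : IsRootedIsoOn H s g ((fun w => Sum.inr (Sum.inr w)) ⁻¹' S)
      ((fun w => Sum.inr (Sum.inr w)) ⁻¹' T)) :
    IsRootedIsoOn (attachTwoCopies H s) (Sum.inl ()) (Sum.map id (Sum.map f g)) S T := by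
  obtain ⟨⟨hfm, hfi, hfs⟩, hfa, hfr⟩ := hf
  obtain ⟨⟨hgm, hgi, hgs⟩, hga, hgr⟩ := hg
  refine ⟨⟨?_, ?_, ?_⟩, ?_, ?_⟩
  · rintro (u | a | a) ha
    exacts [hT, hfm ha, hgm ha]
  · rintro (u | a | a) ha (v | b | b) hb hab <;> simp at hab ⊢
    exacts [hfi ha hb hab, hgi ha hb hab]
  · rintro (u | b | b) hb
    · exact ⟨Sum.inl (), hS, rfl⟩
    · obtain ⟨a, ha, rfl⟩ := hfs hb
      exact ⟨_, ha, rfl⟩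
    · obtain ⟨a, ha, rfl⟩ := hgs hb
      exact ⟨_, ha, rfl⟩
  · rintro (u | a | a) ha (v | b | b) hb <;> simp
    exacts [hfr b hb, hgr b hb, hfr a ha, hfa a ha b hb, hgr a ha, hga a ha b hb]
  · rintro (u | a | a) ha <;> simp

theorem isRootedIsoOn_attachTwoCopies_swap {S T : Set (Unit ⊕ W ⊕ W)} (hS : Sum.inl () ∈ S)
    (hT : Sum.inl () ∈ T) {f g : W → W}
    (hf : IsRootedIsoOn H s f ((fun w => Sum.inr (Sum.inl w)) ⁻¹' S)
      ((fun w => Sum.inr (Sum.inr w)) ⁻¹' T))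
    (hg : IsRootedIsoOn H s g ((fun w => Sum.inr (Sum.inr w)) ⁻¹' S)
      ((fun w => Sum.inr (Sum.inl w)) ⁻¹' T)) :
    IsRootedIsoOn (attachTwoCopies H s) (Sum.inl ())
      (Sum.map id (Sum.swap ∘ Sum.map f g)) S T := by
  obtain ⟨⟨hfm, hfi, hfs⟩, hfa, hfr⟩ := hf
  obtain ⟨⟨hgm, hgi, hgs⟩, hga, hgr⟩ := hg
  refine ⟨⟨?_, ?_, ?_⟩, ?_, ?_⟩
  · rintro (u | a | a) ha
    exacts [hT, hfm ha, hgm ha]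
  · rintro (u | a | a) ha (v | b | b) hb hab <;> simp at hab ⊢
    exacts [hfi ha hb hab, hgi ha hb hab]
  · rintro (u | b | b) hb
    · exact ⟨Sum.inl (), hS, rfl⟩
    · obtain ⟨a, ha, rfl⟩ := hgs hb
      exact ⟨_, ha, rfl⟩
    · obtain ⟨a, ha, rfl⟩ := hfs hb
      exact ⟨_, ha, rfl⟩
  · rintro (u | a | a) ha (v | b | b) hb <;> simp
    exacts [hfr b hb, hgr b hb, hfr a ha, hfa a ha b hb, hgr a ha, hga a ha b hb]
  · rintro (u | a | a) ha <;> simp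

/-- The unordered pair of classes of the two branches of a subtree of `attachTwoCopies H s`
containing the root. -/
noncomputable def branchPair (S : RootedSubtree (attachTwoCopies H s) (Sum.inl ())) :
    Sym2 (Option (Quot (RootedSubtreeIso H s))) :=
  s(branchClass H s ((fun w => Sum.inr (Sum.inl w)) ⁻¹' S.1),
    branchClass H s ((fun w => Sum.inr (Sum.inr w)) ⁻¹' S.1))

theorem rootedSubtreeIso_of_branchPair_eq
    {S T : RootedSubtree (attachTwoCopies H s) (Sum.inl ())} (h : branchPair S = branchPair T) :
    RootedSubtreeIso (attachTwoCopies H s) (Sum.inl ()) S T := by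
  rcases Sym2.eq_iff.1 h with ⟨h₁, h₂⟩ | ⟨h₁, h₂⟩
  · obtain ⟨f, hf⟩ :=
      exists_isRootedIsoOn_of_branchClass_eq (isBranch_left S) (isBranch_left T) h₁
    obtain ⟨g, hg⟩ :=
      exists_isRootedIsoOn_of_branchClass_eq (isBranch_right S) (isBranch_right T) h₂
    exact rootedSubtreeIso_of_isRootedIsoOn (isRootedIsoOn_attachTwoCopies S.2.1 T.2.1 hf hg)
  · obtain ⟨f, hf⟩ :=
      exists_isRootedIsoOn_of_branchClass_eq (isBranch_left S) (isBranch_right T) h₁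
    obtain ⟨g, hg⟩ :=
      exists_isRootedIsoOn_of_branchClass_eq (isBranch_right S) (isBranch_left T) h₂
    exact rootedSubtreeIso_of_isRootedIsoOn
      (isRootedIsoOn_attachTwoCopies_swap S.2.1 T.2.1 hf hg)

end attachTwoCopies

/-- If `T` is obtained from a new root `r` by attaching two disjoint copies of a
rooted tree `B`, then `nr T ≤ (nr B + 1)(nr B + 2)/2`. -/
theorem nr_attachTwoCopies_le {W : Type*} [Fintype W] (H : SimpleGraph W) (s : W)
    (hH : H.IsTree) :
    nr (attachTwoCopies H s) (Sum.inl ()) ≤ (nr H s + 1) * (nr H s + 2) / 2 := by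
  classical
  have hfin : Finite (RootedSubtree H s) := Subtype.finite
  have : Fintype (Quot (RootedSubtreeIso H s)) := Fintype.ofFinite _
  have hinj : Function.Injective
      fun q : Quot (RootedSubtreeIso (attachTwoCopies H s) (Sum.inl ())) => branchPair q.out := by
    intro p q h
    rw [← Quot.out_eq p, ← Quot.out_eq q]
    exact Quot.sound (rootedSubtreeIso_of_branchPair_eq h)
  refine (Nat.card_le_card_of_injective _ hinj).trans_eq ?_
  rw [Nat.card_eq_fintype_card, Sym2.card, Fintype.card_option, Nat.choose_two_right, nr,
    Nat.card_eq_fintype_card, Nat.add_sub_cancel, mul_comm]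
end

section
/- There exists a rooted tree E₅ with exactly 4 vertices and nr(E₅) = 5 (the root with two children, one of which has a further child); consequently R₄ = 5, and nr(E₅)^{1/|E₅|} = 5^{1/4} is the maximum of nr(T)^{1/|T|} over all rooted trees T. -/
open SimpleGraph

/-- A triple `(a, b, c)` encodes the quadratic function `j ↦ a + b * j + c * (j choose 2)`. -/
def quadEval (t : ℕ × ℕ × ℕ) (j : ℕ) : ℕ := t.1 + t.2.1 * j + t.2.2 * j.choose 2

/-- The operator `φ ↦ x * φ + φ (· + 1)` on quadratic functions. -/
def absorb (x : ℕ) (t : ℕ × ℕ × ℕ) : ℕ × ℕ × ℕ :=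
  ((x + 1) * t.1 + t.2.1, (x + 1) * t.2.1 + t.2.2, (x + 1) * t.2.2)

lemma quadEval_absorb (x : ℕ) (t : ℕ × ℕ × ℕ) (j : ℕ) :
    quadEval (absorb x t) j = x * quadEval t j + quadEval t (j + 1) := by
  have h : (j + 1).choose 2 = j.choose 2 + j := by
    rw [Nat.choose_succ_succ' j 1, Nat.choose_one_right, add_comm]
  simp only [quadEval, absorb, h]
  ring

lemma absorb_commute (x y : ℕ) : Function.Commute (absorb x) (absorb y) := by
  intro t
  simp only [absorb, Prod.mk.injEq]
  refine ⟨?_, ?_, ?_⟩ <;> ring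

/-- Coefficientwise domination `d * t ≤ n * u`. -/
def QuadDom (d n : ℕ) (t u : ℕ × ℕ × ℕ) : Prop :=
  d * t.1 ≤ n * u.1 ∧ d * t.2.1 ≤ n * u.2.1 ∧ d * t.2.2 ≤ n * u.2.2

lemma QuadDom.absorb {d n : ℕ} {t u : ℕ × ℕ × ℕ} (h : QuadDom d n t u) (x : ℕ) :
    QuadDom d n (absorb x t) (absorb x u) := by
  obtain ⟨h1, h2, h3⟩ := h
  refine ⟨?_, ?_, ?_⟩ <;> simp only [_root_.absorb]
  · have := Nat.mul_le_mul_left (x + 1) h1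
    linarith
  · have := Nat.mul_le_mul_left (x + 1) h2
    linarith
  · have := Nat.mul_le_mul_left (x + 1) h3
    linarith

lemma QuadDom.iterate_absorb {d n : ℕ} {t u : ℕ × ℕ × ℕ} (h : QuadDom d n t u) (x k : ℕ) :
    QuadDom d n ((_root_.absorb x)^[k] t) ((_root_.absorb x)^[k] u) := by
  induction k with
  | zero => exact h
  | succ k ih =>
    rw [Function.iterate_succ_apply', Function.iterate_succ_apply']
    exact ih.absorb x

/-- The shifted quadratic function is at most `n / d` times the function, coefficientwise. -/
def ShiftLe (d n : ℕ) (t : ℕ × ℕ × ℕ) : Prop :=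
  QuadDom d n (absorb 0 t) t

lemma ShiftLe.iterate_absorb {d n : ℕ} {t : ℕ × ℕ × ℕ} (h : ShiftLe d n t) (x k : ℕ) :
    ShiftLe d n ((absorb x)^[k] t) := by
  have := QuadDom.iterate_absorb h x k
  rwa [← ((absorb_commute 0 x).iterate_right k).eq] at this

lemma ShiftLe.absorb_dom {d n : ℕ} {t : ℕ × ℕ × ℕ} (h : ShiftLe d n t) (x : ℕ) :
    QuadDom d (d * x + n) (absorb x t) t := by
  obtain ⟨h1, h2, h3⟩ := h
  simp only [absorb] at h1 h2 h3
  refine ⟨?_, ?_, ?_⟩ <;> simp only [absorb] <;> nlinarith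

/-- Bound for the number of root subtrees of a tree whose root has `p` leaf branches,
`k` branches on two vertices, and `a, e, f, s, h` branches on `3, 4, 5, 6, 7` vertices. -/
def branchBound (p k a e f s h : ℕ) : ℕ × ℕ × ℕ :=
  (absorb 14)^[h] ((absorb 9)^[s] ((absorb 5)^[f] ((absorb 3)^[e]
    ((absorb 1)^[a] ((absorb 0)^[k] (p + 1, p + 2, 1))))))

/-- The size of a tree with the branches described in `branchBound`. -/
def branchSize (p k a e f s h : ℕ) : ℕ := 1 + p + 2 * k + 3 * a + 4 * e + 5 * f + 6 * s + 7 * h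

/-- Check `F` at the first `n` iterates of `absorb x`, the weight growing by `w` at each step. -/
def checkIter (x w : ℕ) (F : ℕ × ℕ × ℕ → ℕ → Bool) : ℕ → ℕ × ℕ × ℕ → ℕ → Bool
  | 0, _, _ => true
  | n + 1, t, m => F t m && checkIter x w F n (absorb x t) (m + w)

lemma checkIter_spec {x w : ℕ} {F : ℕ × ℕ × ℕ → ℕ → Bool} {n : ℕ} {t : ℕ × ℕ × ℕ} {m : ℕ}
    (h : checkIter x w F n t m) {j : ℕ} (hj : j < n) : F ((absorb x)^[j] t) (m + w * j) := by
  induction n generalizing t m j with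
  | zero => omega
  | succ n ih =>
    rw [checkIter, Bool.and_eq_true] at h
    cases j with
    | zero => exact h.1
    | succ j =>
      have := ih h.2 (Nat.lt_of_succ_lt_succ hj)
      rwa [Function.iterate_succ_apply, mul_add_one, add_comm (w * j), ← add_assoc]

/-- The bound for the value `t.1` on trees with `m` vertices. -/
def checkBound (t : ℕ × ℕ × ℕ) (m : ℕ) : Bool :=
  Nat.ble ((t.1 + cond (Nat.ble 8 m) 1 0) ^ 4) (5 ^ m)

/-- `checkBound` for small numbers of branches on `2` to `7` vertices. -/
def checkBranches : ℕ × ℕ × ℕ → ℕ → Bool :=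
  checkIter 0 2 (checkIter 1 3 (checkIter 3 4 (checkIter 5 5 (checkIter 9 6
    (checkIter 14 7 checkBound 3) 7) 3) 2) 4) 5

lemma checkBranches_small : ∀ p < 8, checkBranches (p + 1, p + 2, 1) (1 + p) := by
  decide +kernel

lemma branchBound_small {p k a e f s h : ℕ} (hp : p < 8) (hk : k < 5) (ha : a < 4) (he : e < 2)
    (hf : f < 3) (hs : s < 7) (hh : h < 3) :
    ((branchBound p k a e f s h).1 + if 8 ≤ branchSize p k a e f s h then 1 else 0) ^ 4 ≤
      5 ^ branchSize p k a e f s h := by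
  have H := checkIter_spec (checkIter_spec (checkIter_spec (checkIter_spec (checkIter_spec
    (checkIter_spec (checkBranches_small p hp) hk) ha) he) hf) hs) hh
  rw [checkBound, Nat.ble_eq] at H
  change ((branchBound p k a e f s h).1 + cond (Nat.ble 8 (branchSize p k a e f s h)) 1 0) ^ 4 ≤
    5 ^ branchSize p k a e f s h at H
  split_ifs with h8
  · rwa [Nat.ble_eq_true_of_le h8] at H
  · rwa [Bool.eq_false_iff.2 fun h => h8 (Nat.le_of_ble_eq_true h)] at H

lemma pow_le_of_dom {d n m a b s : ℕ} (hd : 0 < d) (hdn : d ≤ n) (hm : n ^ 4 ≤ d ^ 4 * 5 ^ m)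
    (hab : d * a ≤ n * b) (hb : (b + 1) ^ 4 ≤ 5 ^ s) : (a + 1) ^ 4 ≤ 5 ^ (s + m) := by
  have h1 : d * (a + 1) ≤ n * (b + 1) := by linarith
  have h2 := Nat.pow_le_pow_left h1 4
  rw [mul_pow, mul_pow] at h2
  have h3 : n ^ 4 * (b + 1) ^ 4 ≤ d ^ 4 * 5 ^ m * 5 ^ s := Nat.mul_le_mul hm hb
  have h4 : d ^ 4 * (a + 1) ^ 4 ≤ d ^ 4 * 5 ^ (s + m) := by
    calc _ ≤ _ := h2.trans h3
      _ = _ := by ring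
  exact Nat.le_of_mul_le_mul_left h4 (by positivity)

/-- `BranchGood p k a e f s h`: the bound holds with one unit to spare. -/
def BranchGood (p k a e f s h : ℕ) : Prop :=
  ((branchBound p k a e f s h).1 + 1) ^ 4 ≤ 5 ^ branchSize p k a e f s h

lemma BranchGood.extend_leaf {p k a e f s h : ℕ} (hp : 7 ≤ p) (H : BranchGood 7 k a e f s h) :
    BranchGood p k a e f s h := by
  induction p, hp using Nat.le_induction with
  | base => exact H
  | succ p hp ih =>
    have hdom : QuadDom 3 4 (p + 1 + 1, p + 1 + 2, 1) (p + 1, p + 2, 1) := by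
      refine ⟨?_, ?_, ?_⟩ <;> simp only <;> omega
    have := (((((hdom.iterate_absorb 0 k).iterate_absorb 1 a).iterate_absorb 3 e).iterate_absorb
      5 f).iterate_absorb 9 s).iterate_absorb 14 h
    have key := pow_le_of_dom (m := 1) (by norm_num) (by norm_num) (by norm_num) this.1 ih
    have hsize : branchSize (p + 1) k a e f s h = branchSize p k a e f s h + 1 := by
      simp only [branchSize]; ring
    rwa [BranchGood, hsize]

lemma shiftLe_two (p : ℕ) : ShiftLe 1 2 ((absorb 0)^[4] (p + 1, p + 2, 1)) := by
  refine ⟨?_, ?_, ?_⟩ <;>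
    simp only [absorb, Function.iterate_succ, Function.iterate_zero, Function.comp, id] <;> omega

lemma shiftLe_three (p : ℕ) : ShiftLe 10 23 ((absorb 1)^[3] (p + 1, p + 2, 1)) := by
  refine ⟨?_, ?_, ?_⟩ <;>
    simp only [absorb, Function.iterate_succ, Function.iterate_zero, Function.comp, id] <;> omega

lemma shiftLe_five (p : ℕ) : ShiftLe 10 24 ((absorb 5)^[2] (p + 1, p + 2, 1)) := by
  refine ⟨?_, ?_, ?_⟩ <;>
    simp only [absorb, Function.iterate_succ, Function.iterate_zero, Function.comp, id] <;> omega

lemma shiftLe_six (p : ℕ) : ShiftLe 20 43 ((absorb 9)^[6] (p + 1, p + 2, 1)) := by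
  refine ⟨?_, ?_, ?_⟩ <;>
    simp only [absorb, Function.iterate_succ, Function.iterate_zero, Function.comp, id] <;> omega

lemma shiftLe_seven (p : ℕ) : ShiftLe 10 27 ((absorb 14)^[2] (p + 1, p + 2, 1)) := by
  refine ⟨?_, ?_, ?_⟩ <;>
    simp only [absorb, Function.iterate_succ, Function.iterate_zero, Function.comp, id] <;> omega

lemma absorb_iterate_comm (x y m n : ℕ) (t : ℕ × ℕ × ℕ) :
    (absorb x)^[m] ((absorb y)^[n] t) = (absorb y)^[n] ((absorb x)^[m] t) :=
  ((absorb_commute x y).iterate_iterate m n).eq t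

lemma ShiftLe.iterate_ge {d n x m : ℕ} {t : ℕ × ℕ × ℕ} (h : ShiftLe d n ((absorb x)^[m] t))
    {m' : ℕ} (hm : m ≤ m') : ShiftLe d n ((absorb x)^[m'] t) := by
  obtain ⟨i, rfl⟩ := Nat.exists_eq_add_of_le' hm
  rw [Function.iterate_add_apply]
  exact h.iterate_absorb x i

lemma BranchGood.extend_two {p k a e f s h : ℕ} (hk : 4 ≤ k) (H : BranchGood p 4 a e f s h) :
    BranchGood p k a e f s h := by
  induction k, hk using Nat.le_induction with
  | base => exact H
  | succ k hk ih =>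
    have hdom := ((shiftLe_two p).iterate_ge hk).absorb_dom 0
    rw [← Function.iterate_succ_apply' (absorb 0)] at hdom
    have := ((((hdom.iterate_absorb 1 a).iterate_absorb 3 e).iterate_absorb
      5 f).iterate_absorb 9 s).iterate_absorb 14 h
    have key := pow_le_of_dom (m := 2) (by norm_num) (by norm_num) (by norm_num) this.1 ih
    have hsize : branchSize p (k + 1) a e f s h = branchSize p k a e f s h + 2 := by
      simp only [branchSize]; ring
    rwa [BranchGood, hsize]

lemma BranchGood.extend_three {p k a e f s h : ℕ} (ha : 3 ≤ a) (H : BranchGood p k 3 e f s h) :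
    BranchGood p k a e f s h := by
  induction a, ha using Nat.le_induction with
  | base => exact H
  | succ a ha ih =>
    have hs := ((shiftLe_three p).iterate_ge ha).iterate_absorb 0 k
    rw [absorb_iterate_comm] at hs
    have hdom := hs.absorb_dom 1
    rw [← Function.iterate_succ_apply' (absorb 1)] at hdom
    have := (((hdom.iterate_absorb 3 e).iterate_absorb
      5 f).iterate_absorb 9 s).iterate_absorb 14 h
    have key := pow_le_of_dom (m := 3) (by norm_num) (by norm_num) (by norm_num) this.1 ih
    have hsize : branchSize p k (a + 1) e f s h = branchSize p k a e f s h + 3 := by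
      simp only [branchSize]; ring
    rwa [BranchGood, hsize]

lemma BranchGood.extend_five {p k a e f s h : ℕ} (hf : 2 ≤ f) (H : BranchGood p k a e 2 s h) :
    BranchGood p k a e f s h := by
  induction f, hf using Nat.le_induction with
  | base => exact H
  | succ f hf ih =>
    have hs := ((((shiftLe_five p).iterate_ge hf).iterate_absorb 0 k).iterate_absorb
      1 a).iterate_absorb 3 e
    rw [absorb_iterate_comm 0 5, absorb_iterate_comm 1 5, absorb_iterate_comm 3 5] at hs
    have hdom := hs.absorb_dom 5
    rw [← Function.iterate_succ_apply' (absorb 5)] at hdom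
    have := (hdom.iterate_absorb 9 s).iterate_absorb 14 h
    have key := pow_le_of_dom (m := 5) (by norm_num) (by norm_num) (by norm_num) this.1 ih
    have hsize : branchSize p k a e (f + 1) s h = branchSize p k a e f s h + 5 := by
      simp only [branchSize]; ring
    rwa [BranchGood, hsize]

lemma BranchGood.extend_six {p k a e f s h : ℕ} (hs : 6 ≤ s) (H : BranchGood p k a e f 6 h) :
    BranchGood p k a e f s h := by
  induction s, hs using Nat.le_induction with
  | base => exact H
  | succ s hs ih =>
    have hs := (((((shiftLe_six p).iterate_ge hs).iterate_absorb 0 k).iterate_absorb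
      1 a).iterate_absorb 3 e).iterate_absorb 5 f
    rw [absorb_iterate_comm 0 9, absorb_iterate_comm 1 9, absorb_iterate_comm 3 9,
      absorb_iterate_comm 5 9] at hs
    have hdom := hs.absorb_dom 9
    rw [← Function.iterate_succ_apply' (absorb 9)] at hdom
    have := hdom.iterate_absorb 14 h
    have key := pow_le_of_dom (m := 6) (by norm_num) (by norm_num) (by norm_num) this.1 ih
    have hsize : branchSize p k a e f (s + 1) h = branchSize p k a e f s h + 6 := by
      simp only [branchSize]; ring
    rwa [BranchGood, hsize]

lemma BranchGood.extend_seven {p k a e f s h : ℕ} (hh : 2 ≤ h) (H : BranchGood p k a e f s 2) :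
    BranchGood p k a e f s h := by
  induction h, hh using Nat.le_induction with
  | base => exact H
  | succ h hh ih =>
    have hs := ((((((shiftLe_seven p).iterate_ge hh).iterate_absorb 0 k).iterate_absorb
      1 a).iterate_absorb 3 e).iterate_absorb 5 f).iterate_absorb 9 s
    rw [absorb_iterate_comm 0 14, absorb_iterate_comm 1 14, absorb_iterate_comm 3 14,
      absorb_iterate_comm 5 14, absorb_iterate_comm 9 14] at hs
    have this := hs.absorb_dom 14
    rw [← Function.iterate_succ_apply' (absorb 14)] at this
    have key := pow_le_of_dom (m := 7) (by norm_num) (by norm_num) (by norm_num) this.1 ih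
    have hsize : branchSize p k a e f s (h + 1) = branchSize p k a e f s h + 7 := by
      simp only [branchSize]; ring
    rwa [BranchGood, hsize]

lemma branchGood_of_le_size {p k a e f s h : ℕ} (he : e ≤ 1)
    (hn : 8 ≤ branchSize p k a e f s h) : BranchGood p k a e f s h := by
  have H : BranchGood (min p 7) (min k 4) (min a 3) e (min f 2) (min s 6) (min h 2) := by
    have := branchBound_small (p := min p 7) (k := min k 4) (a := min a 3) (e := e) (f := min f 2)
      (s := min s 6) (h := min h 2) (by omega) (by omega) (by omega) (by omega) (by omega)
      (by omega) (by omega)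
    rwa [if_pos (by simp only [branchSize] at hn ⊢; omega)] at this
  have H : BranchGood p (min k 4) (min a 3) e (min f 2) (min s 6) (min h 2) := by
    rcases le_total p 7 with h' | h'
    · rwa [min_eq_left h'] at H
    · rw [min_eq_right h'] at H; exact H.extend_leaf h'
  have H : BranchGood p k (min a 3) e (min f 2) (min s 6) (min h 2) := by
    rcases le_total k 4 with h' | h'
    · rwa [min_eq_left h'] at H
    · rw [min_eq_right h'] at H; exact H.extend_two h'
  have H : BranchGood p k a e (min f 2) (min s 6) (min h 2) := by
    rcases le_total a 3 with h' | h'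
    · rwa [min_eq_left h'] at H
    · rw [min_eq_right h'] at H; exact H.extend_three h'
  have H : BranchGood p k a e f (min s 6) (min h 2) := by
    rcases le_total f 2 with h' | h'
    · rwa [min_eq_left h'] at H
    · rw [min_eq_right h'] at H; exact H.extend_five h'
  have H : BranchGood p k a e f s (min h 2) := by
    rcases le_total s 6 with h' | h'
    · rwa [min_eq_left h'] at H
    · rw [min_eq_right h'] at H; exact H.extend_six h'
  rcases le_total h 2 with h' | h'
  · rwa [min_eq_left h'] at H
  · rw [min_eq_right h'] at H; exact H.extend_seven h'

lemma branchBound_pow_le {p k a e f s h : ℕ} (he : e ≤ 1) :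
    (branchBound p k a e f s h).1 ^ 4 ≤ 5 ^ branchSize p k a e f s h := by
  by_cases hn : 8 ≤ branchSize p k a e f s h
  · exact (Nat.pow_le_pow_left (Nat.le_succ _) 4).trans (branchGood_of_le_size he hn)
  · have hn' := hn
    simp only [branchSize] at hn'
    have := branchBound_small (p := p) (k := k) (a := a) (e := e) (f := f) (s := s) (h := h)
      (by omega) (by omega) (by omega) (by omega) (by omega) (by omega) (by omega)
    rwa [if_neg hn] at this

/-- The families of at most one element of `A`. -/
def atMostOne (A : Finset ℕ) : Finset (Multiset ℕ) :=
  insert 0 (A.image fun x => ({x} : Multiset ℕ))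

open scoped Pointwise in
/-- Sum of the families of at most one element from each of the given finsets. -/
def forest (bs : Multiset (ℕ × Finset ℕ)) : Finset (Multiset ℕ) :=
  (bs.map fun b => atMostOne b.2).sum

/-- `CodeSet n A`: the finset `A` consists of the codes of the root subtrees of some rooted
tree with `n` vertices, a tree being coded by the multiset of the codes of its branches. -/
inductive CodeSet : ℕ → Finset ℕ → Prop
  | node (bs : Multiset (ℕ × Finset ℕ)) (h : ∀ b ∈ bs, CodeSet b.1 b.2) :
      CodeSet (1 + (bs.map Prod.fst).sum) ((forest bs).image Encodable.encode)

section Forest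

open scoped Pointwise

lemma card_atMostOne (A : Finset ℕ) : (atMostOne A).card = A.card + 1 := by
  rw [atMostOne, Finset.card_insert_of_notMem (by simp),
    Finset.card_image_of_injective _ fun x y h => Multiset.singleton_inj.1 h]

lemma zero_mem_atMostOne (A : Finset ℕ) : 0 ∈ atMostOne A := Finset.mem_insert_self _ _

lemma singleton_mem_atMostOne {A : Finset ℕ} {x : ℕ} (hx : x ∈ A) : {x} ∈ atMostOne A :=
  Finset.mem_insert_of_mem (Finset.mem_image_of_mem _ hx)

@[simp] lemma forest_zero : forest 0 = 0 := rfl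

@[simp] lemma forest_cons (b : ℕ × Finset ℕ) (bs : Multiset (ℕ × Finset ℕ)) :
    forest (b ::ₘ bs) = atMostOne b.2 + forest bs := by
  simp [forest]

lemma forest_add (bs cs : Multiset (ℕ × Finset ℕ)) :
    forest (bs + cs) = forest bs + forest cs := by
  simp [forest]

lemma zero_mem_forest (bs : Multiset (ℕ × Finset ℕ)) : 0 ∈ forest bs := by
  induction bs using Multiset.induction with
  | empty => simp
  | cons b bs ih =>
    rw [forest_cons]
    exact Finset.mem_add.2 ⟨0, zero_mem_atMostOne _, 0, ih, rfl⟩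

lemma singleton_mem_forest {bs : Multiset (ℕ × Finset ℕ)} {b : ℕ × Finset ℕ} (hb : b ∈ bs)
    {x : ℕ} (hx : x ∈ b.2) : {x} ∈ forest bs := by
  obtain ⟨cs, rfl⟩ := Multiset.exists_cons_of_mem hb
  rw [forest_cons]
  exact Finset.mem_add.2 ⟨{x}, singleton_mem_atMostOne hx, 0, zero_mem_forest _, by simp⟩

lemma card_image_encode (s : Finset (Multiset ℕ)) :
    (s.image Encodable.encode).card = s.card :=
  Finset.card_image_of_injective _ Encodable.encode_injective

/-- The code of the tree with one vertex. -/
def leafCode : ℕ := Encodable.encode (0 : Multiset ℕ)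

/-- The code of the tree with two vertices. -/
def edgeCode : ℕ := Encodable.encode ({leafCode} : Multiset ℕ)

lemma leafCode_ne_edgeCode : leafCode ≠ edgeCode := by
  intro h
  have := Encodable.encode_injective h
  simp at this

lemma CodeSet.one_le {n : ℕ} {A : Finset ℕ} (h : CodeSet n A) : 1 ≤ n := by
  cases h; omega

lemma CodeSet.leafCode_mem {n : ℕ} {A : Finset ℕ} (h : CodeSet n A) : leafCode ∈ A := by
  cases h
  exact Finset.mem_image_of_mem _ (zero_mem_forest _)

lemma CodeSet.edgeCode_mem {n : ℕ} {A : Finset ℕ} (h : CodeSet n A) (hn : 2 ≤ n) :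
    edgeCode ∈ A := by
  cases h with
  | node bs h =>
    obtain ⟨b, hb⟩ := Multiset.exists_mem_of_ne_zero (s := bs) (by rintro rfl; simp at hn)
    exact Finset.mem_image_of_mem _ (singleton_mem_forest hb (h b hb).leafCode_mem)

lemma CodeSet.eq_of_one {A : Finset ℕ} (h : CodeSet 1 A) : A = {leafCode} := by
  generalize hn : 1 = n at h
  cases h with
  | node bs h =>
    rcases Multiset.empty_or_exists_mem bs with rfl | ⟨b, hb⟩
    · simp [leafCode]
    · obtain ⟨cs, rfl⟩ := Multiset.exists_cons_of_mem hb
      have := (h b hb).one_le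
      simp at hn
      omega

lemma card_core_le (j p : ℕ) :
    (j • atMostOne {leafCode, edgeCode} + p • atMostOne {leafCode}).card ≤
      quadEval (p + 1, p + 2, 1) j := by
  have hp : ∀ m ∈ p • atMostOne {leafCode}, ∃ a, a ≤ p ∧ m = a • {leafCode} := by
    induction p with
    | zero => intro m hm; exact ⟨0, le_rfl, by simpa using hm⟩
    | succ p ih =>
      intro m hm
      rw [succ_nsmul, Finset.mem_add] at hm
      obtain ⟨y, hy, z, hz, rfl⟩ := hm
      obtain ⟨a, ha, rfl⟩ := ih y hy
      simp only [atMostOne, Finset.image_singleton, Finset.mem_insert, Finset.mem_singleton] at hz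
      rcases hz with rfl | rfl
      · exact ⟨a, by omega, by simp⟩
      · exact ⟨a + 1, by omega, by rw [succ_nsmul]⟩
  have hj : ∀ m ∈ j • atMostOne {leafCode, edgeCode}, ∃ a b, a + b ≤ j ∧
      m = a • {leafCode} + b • {edgeCode} := by
    clear hp
    induction j with
    | zero => intro m hm; exact ⟨0, 0, le_rfl, by simpa using hm⟩
    | succ j ih =>
      intro m hm
      rw [succ_nsmul, Finset.mem_add] at hm
      obtain ⟨y, hy, z, hz, rfl⟩ := hm
      obtain ⟨a, b, hab, rfl⟩ := ih y hy
      simp only [atMostOne, Finset.image_insert, Finset.image_singleton, Finset.mem_insert,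
        Finset.mem_singleton] at hz
      rcases hz with rfl | rfl | rfl
      · exact ⟨a, b, by omega, by simp⟩
      · exact ⟨a + 1, b, by omega, by rw [succ_nsmul]; abel⟩
      · exact ⟨a, b + 1, by omega, by rw [succ_nsmul]; abel⟩
  have hsub : j • atMostOne {leafCode, edgeCode} + p • atMostOne {leafCode} ⊆
      ((Finset.range (j + 1)).sigma fun i => Finset.range (i + p + 1)).image
        fun q => q.2 • {leafCode} + (j - q.1) • {edgeCode} := by
    intro m hm
    obtain ⟨y, hy, z, hz, rfl⟩ := Finset.mem_add.1 hm
    obtain ⟨a, b, hab, rfl⟩ := hj y hy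
    obtain ⟨c, hc, rfl⟩ := hp z hz
    refine Finset.mem_image.2 ⟨⟨j - b, a + c⟩, ?_, ?_⟩
    · simp only [Finset.mem_sigma, Finset.mem_range]; omega
    · simp only [show j - (j - b) = b by omega, add_nsmul]; abel
  refine (Finset.card_le_card hsub).trans (Finset.card_image_le.trans ?_)
  rw [Finset.card_sigma]
  simp only [Finset.card_range]
  clear hsub hj hp
  induction j with
  | zero => simp [quadEval]
  | succ j ih =>
    rw [Finset.sum_range_succ]
    have h : (j + 1).choose 2 = j.choose 2 + j := by
      rw [Nat.choose_succ_succ' j 1, Nat.choose_one_right, add_comm]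
    simp only [quadEval, h] at ih ⊢
    linarith

lemma card_absorb_le {A : Finset ℕ} {x : ℕ} (hleaf : leafCode ∈ A) (hedge : edgeCode ∈ A)
    (hA : A.card ≤ x + 2) {R : Finset (Multiset ℕ)} {t : ℕ × ℕ × ℕ}
    (hR : ∀ j, (j • atMostOne {leafCode, edgeCode} + R).card ≤ quadEval t j) (j : ℕ) :
    (j • atMostOne {leafCode, edgeCode} + (atMostOne A + R)).card ≤ quadEval (absorb x t) j := by
  set Q := atMostOne {leafCode, edgeCode} with hQ
  set B := (A.erase leafCode).erase edgeCode with hB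
  have hBcard : B.card ≤ x := by
    rw [hB, Finset.card_erase_of_mem (Finset.mem_erase.2 ⟨leafCode_ne_edgeCode.symm, hedge⟩),
      Finset.card_erase_of_mem hleaf]
    omega
  have hsub : j • Q + (atMostOne A + R) ⊆
      ((j + 1) • Q + R) ∪ ((B.image fun x => ({x} : Multiset ℕ)) + (j • Q + R)) := by
    intro m hm
    obtain ⟨y, hy, z, hz, rfl⟩ := Finset.mem_add.1 hm
    obtain ⟨u, hu, v, hv, rfl⟩ := Finset.mem_add.1 hz
    by_cases huQ : u ∈ Q
    · refine Finset.mem_union_left _ (Finset.mem_add.2 ⟨y + u, ?_, v, hv, by abel⟩)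
      rw [succ_nsmul]
      exact Finset.add_mem_add hy huQ
    · refine Finset.mem_union_right _
        (Finset.mem_add.2 ⟨u, ?_, y + v, Finset.add_mem_add hy hv, by abel⟩)
      simp only [atMostOne, hQ, hB, Finset.mem_insert, Finset.mem_image, Finset.mem_singleton,
        Finset.mem_erase] at hu huQ ⊢
      rcases hu with rfl | ⟨a, ha, rfl⟩
      · simp at huQ
      · refine ⟨a, ⟨?_, ?_, ha⟩, rfl⟩ <;> rintro rfl <;> simp at huQ
  calc _ ≤ _ := Finset.card_le_card hsub
    _ ≤ _ := Finset.card_union_le _ _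
    _ ≤ quadEval t (j + 1) + x * quadEval t j := by
        refine Nat.add_le_add (hR _) (Finset.card_add_le.trans ?_)
        exact Nat.mul_le_mul (Finset.card_image_le.trans hBcard) (hR j)
    _ = _ := by rw [quadEval_absorb, add_comm]

lemma card_forest_absorb_le {x : ℕ} {bs : Multiset (ℕ × Finset ℕ)}
    (hbs : ∀ b ∈ bs, leafCode ∈ b.2 ∧ edgeCode ∈ b.2 ∧ b.2.card ≤ x + 2)
    {R : Finset (Multiset ℕ)} {t : ℕ × ℕ × ℕ}
    (hR : ∀ j, (j • atMostOne {leafCode, edgeCode} + R).card ≤ quadEval t j) (j : ℕ) :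
    (j • atMostOne {leafCode, edgeCode} + (forest bs + R)).card ≤
      quadEval ((absorb x)^[bs.card] t) j := by
  induction bs using Multiset.induction generalizing j with
  | empty => simpa using hR j
  | cons b bs ih =>
    obtain ⟨h1, h2, h3⟩ := hbs b (Multiset.mem_cons_self _ _)
    rw [Multiset.card_cons, Function.iterate_succ_apply', forest_cons, add_assoc]
    exact card_absorb_le h1 h2 h3 (ih fun c hc => hbs c (Multiset.mem_cons_of_mem hc)) j

lemma card_forest_cons_lt {b : ℕ × Finset ℕ} {bs : Multiset (ℕ × Finset ℕ)}
    (hb : leafCode ∈ b.2) (hbs : {leafCode} ∈ forest bs) :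
    (forest (b ::ₘ bs)).card < (b.2.card + 1) * (forest bs).card := by
  rw [forest_cons, ← card_atMostOne]
  refine lt_of_le_of_ne Finset.card_add_le fun h => ?_
  have h2 := Finset.card_add_iff.1 h
  have := @h2 ({leafCode}, 0) (Set.mk_mem_prod (singleton_mem_atMostOne hb) (zero_mem_forest _))
    (0, {leafCode}) (Set.mk_mem_prod (zero_mem_atMostOne _) hbs) (by simp)
  simp at this

lemma card_atMostOne_add_self_le {A : Finset ℕ} (hA : A.card ≤ 5) :
    (atMostOne A + atMostOne A).card ≤ 21 := by
  have hsub : atMostOne A + atMostOne A ⊆ (atMostOne A).sym2.image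
      (Sym2.lift ⟨fun x y => x + y, add_comm⟩) := by
    intro m hm
    obtain ⟨y, hy, z, hz, rfl⟩ := Finset.mem_add.1 hm
    exact Finset.mem_image.2 ⟨s(y, z), Finset.mk_mem_sym2_iff.2 ⟨hy, hz⟩, rfl⟩
  refine (Finset.card_le_card hsub).trans (Finset.card_image_le.trans ?_)
  rw [Finset.card_sym2, card_atMostOne]
  exact Nat.choose_le_choose 2 (show A.card + 1 + 1 ≤ 7 by omega)

lemma forest_eq_nsmul {bs : Multiset (ℕ × Finset ℕ)} {A : Finset ℕ} (h : ∀ b ∈ bs, b.2 = A) :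
    forest bs = bs.card • atMostOne A := by
  induction bs using Multiset.induction with
  | empty => simp
  | cons b bs ih =>
    rw [forest_cons, ih fun c hc => h c (Multiset.mem_cons_of_mem hc), h b (by simp),
      Multiset.card_cons, succ_nsmul, add_comm]

lemma CodeSet.forest_eq_nsmul {bs : Multiset (ℕ × Finset ℕ)} (h : ∀ b ∈ bs, CodeSet b.1 b.2)
    (h1 : ∀ b ∈ bs, b.1 = 1) : forest bs = bs.card • atMostOne {leafCode} :=
  _root_.forest_eq_nsmul fun b hb => (h1 b hb ▸ h b hb).eq_of_one

lemma sum_fst_eq {bs : Multiset (ℕ × Finset ℕ)} {i : ℕ} (h : ∀ b ∈ bs, b.1 = i) :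
    (bs.map Prod.fst).sum = bs.card * i := by
  rw [Multiset.map_congr rfl h, Multiset.map_const', Multiset.sum_replicate, smul_eq_mul]

lemma CodeSet.card_le_sum {bs : Multiset (ℕ × Finset ℕ)} (h : ∀ b ∈ bs, CodeSet b.1 b.2) :
    bs.card ≤ (bs.map Prod.fst).sum := by
  induction bs using Multiset.induction with
  | empty => simp
  | cons b bs ih =>
    have := ih fun c hc => h c (Multiset.mem_cons_of_mem hc)
    have := (h b (by simp)).one_le
    simp only [Multiset.card_cons, Multiset.map_cons, Multiset.sum_cons]
    omega

lemma CodeSet.eq_of_two {A : Finset ℕ} (h : CodeSet 2 A) : A = {leafCode, edgeCode} := by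
  generalize hn : 2 = n at h
  cases h with
  | node bs h =>
    obtain ⟨b, hb⟩ := Multiset.exists_mem_of_ne_zero (s := bs) (by rintro rfl; simp at hn)
    obtain ⟨cs, rfl⟩ := Multiset.exists_cons_of_mem hb
    have h1 := card_le_sum fun c hc => h c (Multiset.mem_cons_of_mem hc)
    have h2 := (h b hb).one_le
    rw [Multiset.map_cons, Multiset.sum_cons] at hn
    obtain rfl : cs = 0 := Multiset.card_eq_zero.1 (by omega)
    have hb1 := h b hb
    rw [show b.1 = 1 by omega] at hb1
    rw [forest_cons, hb1.eq_of_one]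
    simp [atMostOne, leafCode, edgeCode]

/-- Among the trees with four vertices at most one set of codes has more than four elements. -/
lemma CodeSet.card_le_or_eq {A : Finset ℕ} (hA : CodeSet 4 A)
    (H : ∀ B, CodeSet 3 B → B.card ≤ 3) :
    A.card ≤ 4 ∨ A = (atMostOne {leafCode, edgeCode} + atMostOne {leafCode}).image
      Encodable.encode := by
  obtain ⟨n, hn, hA⟩ : ∃ n, n = 4 ∧ CodeSet n A := ⟨4, rfl, hA⟩
  cases hA with
  | node bs h =>
    rw [card_image_encode]
    by_cases h1 : ∀ b ∈ bs, b.1 = 1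
    · left
      have hs := sum_fst_eq h1
      have := card_core_le 0 bs.card
      rw [zero_nsmul, zero_add, ← forest_eq_nsmul h h1] at this
      refine this.trans ?_
      simp [quadEval]
      omega
    · push Not at h1
      obtain ⟨b, hb, hb1⟩ := h1
      obtain ⟨cs, rfl⟩ := Multiset.exists_cons_of_mem hb
      have hcs : ∀ c ∈ cs, CodeSet c.1 c.2 := fun c hc => h c (Multiset.mem_cons_of_mem hc)
      have hle := card_le_sum hcs
      have hb2 := (h b hb).one_le
      rw [Multiset.map_cons, Multiset.sum_cons] at hn
      rcases Multiset.empty_or_exists_mem cs with rfl | ⟨c, hc⟩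
      · left
        have hb3 : b.1 = 3 := by simp at hn; omega
        rw [forest_cons, forest_zero, add_zero, card_atMostOne]
        have := H _ (hb3 ▸ h b hb)
        omega
      · right
        obtain ⟨ds, rfl⟩ := Multiset.exists_cons_of_mem hc
        have hle' := card_le_sum fun d hd => hcs d (Multiset.mem_cons_of_mem hd)
        have hc1 := (hcs c hc).one_le
        rw [Multiset.map_cons, Multiset.sum_cons] at hn
        obtain rfl : ds = 0 := Multiset.card_eq_zero.1 (by omega)
        simp only [Multiset.map_zero, Multiset.sum_zero] at hn
        have hb3 := h b hb
        have hc3 := hcs c hc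
        rw [show b.1 = 2 by omega] at hb3
        rw [show c.1 = 1 by omega] at hc3
        rw [forest_cons, forest_cons, forest_zero, add_zero, hb3.eq_of_two, hc3.eq_of_one]

lemma eq_sum_filter {bs : Multiset (ℕ × Finset ℕ)} (h : ∀ b ∈ bs, 1 ≤ b.1 ∧ b.1 < 8) :
    bs = bs.filter (·.1 = 7) + (bs.filter (·.1 = 6) + (bs.filter (·.1 = 5) +
      (bs.filter (·.1 = 4) + (bs.filter (·.1 = 3) + (bs.filter (·.1 = 2) +
        bs.filter (·.1 = 1)))))) := by
  ext ⟨i, A⟩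
  simp only [Multiset.count_add, Multiset.count_filter]
  by_cases hb : (i, A) ∈ bs
  · obtain ⟨h1, h2⟩ := h _ hb
    simp only at h1 h2
    interval_cases i <;> simp
  · simp [Multiset.count_eq_zero_of_notMem hb]

/-- The bound `branchBound` for a forest whose branches have at most seven vertices each. -/
lemma CodeSet.card_forest_le {bs : Multiset (ℕ × Finset ℕ)} (h : ∀ b ∈ bs, CodeSet b.1 b.2)
    (hpow : ∀ b ∈ bs, b.2.card ^ 4 ≤ 5 ^ b.1) (h8 : ∀ b ∈ bs, b.1 < 8) :
    ∃ p k a f s g, 1 + (bs.map Prod.fst).sum =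
        branchSize p k a (bs.filter (·.1 = 4)).card f s g ∧
      (forest bs).card ≤ (branchBound p k a (bs.filter (·.1 = 4)).card f s g).1 := by
  refine ⟨(bs.filter (·.1 = 1)).card, (bs.filter (·.1 = 2)).card, (bs.filter (·.1 = 3)).card,
    (bs.filter (·.1 = 5)).card, (bs.filter (·.1 = 6)).card, (bs.filter (·.1 = 7)).card, ?_, ?_⟩
  · conv_lhs => rw [eq_sum_filter fun b hb => ⟨(h b hb).one_le, h8 b hb⟩]
    have hs : ∀ i, ((bs.filter (·.1 = i)).map Prod.fst).sum = (bs.filter (·.1 = i)).card * i :=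
      fun i => sum_fst_eq fun b hb => (Multiset.mem_filter.1 hb).2
    simp only [Multiset.map_add, Multiset.sum_add, hs, branchSize]
    ring
  · conv_lhs => rw [eq_sum_filter fun b hb => ⟨(h b hb).one_le, h8 b hb⟩]
    have hcond : ∀ i x, 2 ≤ i → 5 ^ i < (x + 3) ^ 4 → ∀ b ∈ bs.filter (·.1 = i),
        leafCode ∈ b.2 ∧ edgeCode ∈ b.2 ∧ b.2.card ≤ x + 2 := by
      intro i x hi hx b hb'
      obtain ⟨hb, rfl⟩ := Multiset.mem_filter.1 hb'
      refine ⟨(h b hb).leafCode_mem, (h b hb).edgeCode_mem hi, ?_⟩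
      have := lt_of_pow_lt_pow_left₀ 4 (by positivity) ((hpow b hb).trans_lt hx)
      omega
    have h1 : ∀ j, (j • atMostOne {leafCode, edgeCode} + forest (bs.filter (·.1 = 1))).card ≤
        quadEval ((bs.filter (·.1 = 1)).card + 1, (bs.filter (·.1 = 1)).card + 2, 1) j := by
      intro j
      rw [forest_eq_nsmul (fun b hb => h b (Multiset.mem_of_mem_filter hb))
        fun b hb => (Multiset.mem_filter.1 hb).2]
      exact card_core_le _ _
    have h2 := card_forest_absorb_le (hcond 2 0 (by norm_num) (by norm_num)) h1
    have h3 := card_forest_absorb_le (hcond 3 1 (by norm_num) (by norm_num)) h2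
    have h4 := card_forest_absorb_le (hcond 4 3 (by norm_num) (by norm_num)) h3
    have h5 := card_forest_absorb_le (hcond 5 5 (by norm_num) (by norm_num)) h4
    have h6 := card_forest_absorb_le (hcond 6 9 (by norm_num) (by norm_num)) h5
    have h7 := card_forest_absorb_le (hcond 7 14 (by norm_num) (by norm_num)) h6 0
    rw [zero_nsmul, zero_add] at h7
    simp only [forest_add]
    simpa [quadEval, branchBound] using h7

/-- A tree with `n` vertices has at most `5 ^ (n / 4)` classes of root subtrees, and at most
`5 ^ (n / 4) - 1` if `n ≥ 8`. -/
theorem CodeSet.card_pow_le {n : ℕ} {A : Finset ℕ} (hA : CodeSet n A) :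
    A.card ^ 4 ≤ 5 ^ n ∧ (8 ≤ n → (A.card + 1) ^ 4 ≤ 5 ^ n) := by
  induction n using Nat.strong_induction_on generalizing A with
  | h n ih =>
  cases hA with
  | node bs h =>
  rw [card_image_encode]
  have weaken : ((forest bs).card + 1) ^ 4 ≤ 5 ^ (1 + (bs.map Prod.fst).sum) →
      (forest bs).card ^ 4 ≤ 5 ^ (1 + (bs.map Prod.fst).sum) ∧
      (8 ≤ 1 + (bs.map Prod.fst).sum →
        ((forest bs).card + 1) ^ 4 ≤ 5 ^ (1 + (bs.map Prod.fst).sum)) :=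
    fun H => ⟨(Nat.pow_le_pow_left (Nat.le_succ _) 4).trans H, fun _ => H⟩
  have hlt : ∀ b ∈ bs, b.1 < 1 + (bs.map Prod.fst).sum := fun b hb => by
    have := Multiset.single_le_sum (fun _ _ => Nat.zero_le _) _
      (Multiset.mem_map_of_mem Prod.fst hb)
    omega
  by_cases hgood : ∃ b ∈ bs, (b.2.card + 1) ^ 4 ≤ 5 ^ b.1
  · obtain ⟨b, hb, hgood⟩ := hgood
    obtain ⟨cs, rfl⟩ := Multiset.exists_cons_of_mem hb
    have hcs : ∀ c ∈ cs, CodeSet c.1 c.2 := fun c hc => h c (Multiset.mem_cons_of_mem hc)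
    rcases Multiset.empty_or_exists_mem cs with rfl | ⟨c, hc⟩
    · simp only [forest_cons, forest_zero, add_zero, card_atMostOne, Multiset.map_cons,
        Multiset.map_zero, Multiset.sum_cons, Multiset.sum_zero, pow_add, pow_one]
      refine ⟨by omega, fun hn => ?_⟩
      have h2 : 2 ≤ b.2.card := by
        rw [← Finset.card_pair leafCode_ne_edgeCode]
        refine Finset.card_le_card fun x hx => ?_
        rcases Finset.mem_insert.1 hx with rfl | hx
        · exact (h b hb).leafCode_mem
        · rw [Finset.mem_singleton.1 hx]
          exact (h b hb).edgeCode_mem (by omega)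
      have h3 := Nat.pow_le_pow_left (show 3 * (b.2.card + 1 + 1) ≤ 4 * (b.2.card + 1) by omega) 4
      rw [mul_pow, mul_pow] at h3
      omega
    · apply weaken
      have hF := card_forest_cons_lt (h b hb).leafCode_mem
        (singleton_mem_forest hc (hcs c hc).leafCode_mem)
      have hrest := (ih _ (by
        have := (h b hb).one_le
        rw [Multiset.map_cons, Multiset.sum_cons]; omega) (CodeSet.node cs hcs)).1
      rw [card_image_encode] at hrest
      calc _ ≤ ((b.2.card + 1) * (forest cs).card) ^ 4 := Nat.pow_le_pow_left hF 4
        _ = (b.2.card + 1) ^ 4 * (forest cs).card ^ 4 := mul_pow _ _ _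
        _ ≤ 5 ^ b.1 * 5 ^ (1 + (cs.map Prod.fst).sum) := Nat.mul_le_mul hgood hrest
        _ = _ := by rw [Multiset.map_cons, Multiset.sum_cons]; ring
  push Not at hgood
  by_cases hfour : (bs.filter (·.1 = 4)).card ≤ 1
  · obtain ⟨p, k, a, f, s, g, hsize, hle⟩ := CodeSet.card_forest_le h
      (fun b hb => (ih b.1 (hlt b hb) (h b hb)).1) fun b hb => by
        by_contra! h8
        exact (hgood b hb).not_ge ((ih b.1 (hlt b hb) (h b hb)).2 h8)
    rw [hsize]
    exact ⟨(Nat.pow_le_pow_left hle 4).trans (branchBound_pow_le hfour), fun hn =>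
      (Nat.pow_le_pow_left (Nat.succ_le_succ hle) 4).trans (branchGood_of_le_size hfour hn)⟩
  · apply weaken
    obtain ⟨es, hes⟩ := Multiset.le_iff_exists_add.1 (Multiset.filter_le (·.1 = 4) bs)
    obtain ⟨b, c, ds, hds⟩ : ∃ b c ds, bs.filter (·.1 = 4) = b ::ₘ c ::ₘ ds := by
      obtain ⟨b, hb⟩ := Multiset.card_pos_iff_exists_mem.1
        (show 0 < (bs.filter (·.1 = 4)).card by omega)
      obtain ⟨t, ht⟩ := Multiset.exists_cons_of_mem hb
      have htcard : 0 < t.card := by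
        rw [ht, Multiset.card_cons] at hfour; omega
      obtain ⟨c, hc⟩ := Multiset.card_pos_iff_exists_mem.1 htcard
      obtain ⟨ds, rfl⟩ := Multiset.exists_cons_of_mem hc
      exact ⟨b, c, ds, ht⟩
    have hb : b ∈ bs.filter (·.1 = 4) := by rw [hds]; simp
    have hc : c ∈ bs.filter (·.1 = 4) := by rw [hds]; simp
    obtain ⟨hb, hb4⟩ := Multiset.mem_filter.1 hb
    obtain ⟨hc, hc4⟩ := Multiset.mem_filter.1 hc
    have key : ∀ b ∈ bs, b.1 = 4 → b.2.card ≤ 5 ∧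
        b.2 = (atMostOne {leafCode, edgeCode} + atMostOne {leafCode}).image Encodable.encode := by
      intro b hb hb4
      have hlt' := hlt b hb
      have hpow := (ih b.1 (hlt b hb) (h b hb)).1
      have hgood := hgood b hb
      rw [hb4] at hpow hgood
      have h5 : b.2.card ≤ 5 := (Nat.pow_le_pow_iff_left four_ne_zero).1 hpow
      have hb' := h b hb
      rw [hb4] at hb'
      have h4 : 4 < b.2.card := by
        by_contra! hle
        have : (b.2.card + 1) ^ 4 ≤ 5 ^ 4 := Nat.pow_le_pow_left (by omega) 4
        omega
      refine ⟨h5, (hb'.card_le_or_eq fun B hB => ?_).resolve_left (by omega)⟩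
      have := lt_of_pow_lt_pow_left₀ 4 (by positivity)
        ((ih 3 (by omega) hB).1.trans_lt (show 5 ^ 3 < 4 ^ 4 by norm_num))
      omega
    obtain ⟨hb5, hbE⟩ := key b hb hb4
    obtain ⟨-, hcE⟩ := key c hc hc4
    rw [hds, Multiset.cons_add, Multiset.cons_add] at hes
    have hF : (forest bs).card ≤ 21 * (forest (ds + es)).card := by
      rw [hes, forest_cons, forest_cons, ← add_assoc, hcE, ← hbE]
      exact Finset.card_add_le.trans (Nat.mul_le_mul_right _ (card_atMostOne_add_self_le hb5))
    have hsum : 1 + (bs.map Prod.fst).sum = 1 + ((ds + es).map Prod.fst).sum + 8 := by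
      rw [hes]
      simp only [Multiset.map_cons, Multiset.sum_cons, hb4, hc4]
      omega
    have hpos : 0 < (forest (ds + es)).card := Finset.card_pos.2 ⟨0, zero_mem_forest _⟩
    have hrest := (ih _ (by omega) (CodeSet.node (ds + es) fun d hd => h d (by
      rw [hes]; exact Multiset.mem_cons_of_mem (Multiset.mem_cons_of_mem hd)))).1
    rw [card_image_encode] at hrest
    have h22 := Nat.pow_le_pow_left
      (show (forest bs).card + 1 ≤ 22 * (forest (ds + es)).card by omega) 4
    rw [mul_pow] at h22
    rw [hsum, pow_add]
    omega

end Forest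

/-- Finsets whose labelings have the same multiset of labels are matched by an injective map. -/
lemma exists_injOn_of_map_eq {α β γ : Type*} {s : Finset α} {t : Finset β} {f : α → γ} {g : β → γ}
    (h : s.val.map f = t.val.map g) (b₀ : β) :
    ∃ e : α → β, (∀ a ∈ s, e a ∈ t ∧ g (e a) = f a) ∧ Set.InjOn e s := by
  classical
  induction s using Finset.induction generalizing t with
  | empty => exact ⟨fun _ => b₀, by simp, by simp⟩
  | insert a s ha ih =>
    rw [Finset.insert_val_of_notMem ha, Multiset.map_cons] at h
    obtain ⟨b, hb, hab⟩ := Multiset.mem_map.1 (h ▸ Multiset.mem_cons_self (f a) _)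
    rw [← Multiset.cons_erase hb, Multiset.map_cons, hab, Multiset.cons_inj_right,
      ← Finset.erase_val] at h
    obtain ⟨e, he, hinj⟩ := ih h
    refine ⟨Function.update e a b, fun x hx => ?_, fun x hx y hy hxy => ?_⟩
    · by_cases hxa : x = a
      · subst hxa; simpa using ⟨hb, hab⟩
      · have := he x (Finset.mem_of_mem_insert_of_ne hx hxa)
        simpa [hxa] using ⟨Finset.mem_of_mem_erase this.1, this.2⟩
    · have hmem {z : α} (hz : z ∈ (insert a s : Finset α)) (hza : z ≠ a) : e z ≠ b :=
        Finset.ne_of_mem_erase (he z (Finset.mem_of_mem_insert_of_ne hz hza)).1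
      by_cases hxa : x = a <;> by_cases hya : y = a
      · rw [hxa, hya]
      · rw [Function.update_of_ne hya, hxa, Function.update_self] at hxy
        exact absurd hxy.symm (hmem hy hya)
      · rw [Function.update_of_ne hxa, hya, Function.update_self] at hxy
        exact absurd hxy (hmem hx hxa)
      · rw [Function.update_of_ne hxa, Function.update_of_ne hya] at hxy
        exact hinj (Finset.mem_of_mem_insert_of_ne hx hxa)
          (Finset.mem_of_mem_insert_of_ne hy hya) hxy

open Classical in
lemma map_filter_mem_forest {V : Type*} {s : Finset V} {S : Set V} {c n : V → ℕ} {A : V → Finset ℕ}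
    (h : ∀ w, c w ∈ A w) :
    (s.filter (· ∈ S)).val.map c ∈ forest (s.val.map fun w => (n w, A w)) := by
  induction s using Finset.induction with
  | empty => simp
  | insert a s ha ih =>
    rw [Finset.insert_val_of_notMem ha, Multiset.map_cons, forest_cons, Finset.filter_insert]
    split_ifs with haS
    · rw [Finset.insert_val_of_notMem (by simp [ha]), Multiset.map_cons,
        ← Multiset.singleton_add]
      exact Finset.add_mem_add (singleton_mem_atMostOne (h a)) ih
    · rw [← zero_add (Multiset.map c _)]
      exact Finset.add_mem_add (zero_mem_atMostOne _) ih

/-- The parent and depth functions of a rooted tree with root `r`. -/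
structure ParentMap {V : Type*} (r : V) where
  /-- The parent of a vertex. -/
  par : V → V
  /-- The depth of a vertex. -/
  depth : V → ℕ
  par_root : par r = r
  depth_root : depth r = 0
  depth_par : ∀ w, w ≠ r → depth (par w) + 1 = depth w

namespace ParentMap

variable {V : Type*} {r : V} (P : ParentMap r)

lemma depth_eq_zero {w : V} : P.depth w = 0 ↔ w = r := by
  refine ⟨fun h => ?_, fun h => h ▸ P.depth_root⟩
  by_contra hw
  have := P.depth_par w hw
  omega

/-- A set of vertices that contains the root and the parents of its other members. -/
def Closed (S : Set V) : Prop :=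
  r ∈ S ∧ ∀ w ∈ S, w ≠ r → P.par w ∈ S

variable [Fintype V]

open Classical in
/-- The children of a vertex. -/
noncomputable def children (v : V) : Finset V :=
  Finset.univ.filter fun w => w ≠ r ∧ P.par w = v

lemma mem_children {v w : V} : w ∈ P.children v ↔ w ≠ r ∧ P.par w = v := by
  simp [children]

open Classical in
/-- The code of the part of `S` at or below a vertex, down to relative depth `k`. -/
noncomputable def code (S : Set V) : ℕ → V → ℕ
  | 0, _ => leafCode
  | k + 1, v => Encodable.encode (((P.children v).filter (· ∈ S)).val.map (code S k))

/-- The number of descendants of a vertex, down to relative depth `k`. -/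
noncomputable def size : ℕ → V → ℕ
  | 0, _ => 1
  | k + 1, v => 1 + ∑ w ∈ P.children v, size k w

/-- The codes of the root subtrees of the branch at a vertex, cut at relative depth `k`. -/
noncomputable def codes : ℕ → V → Finset ℕ
  | 0, _ => {leafCode}
  | k + 1, v => (forest ((P.children v).val.map fun w => (P.size k w, codes k w))).image
      Encodable.encode

lemma codeSet_codes (k : ℕ) (v : V) : CodeSet (P.size k v) (P.codes k v) := by
  induction k generalizing v with
  | zero => simpa [size, codes, leafCode] using CodeSet.node 0 (by simp)
  | succ k ih =>
    have := CodeSet.node ((P.children v).val.map fun w => (P.size k w, P.codes k w)) (by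
      intro b hb
      obtain ⟨w, -, rfl⟩ := Multiset.mem_map.1 hb
      exact ih w)
    rw [Multiset.map_map] at this
    exact this

lemma code_mem_codes (S : Set V) (k : ℕ) (v : V) : P.code S k v ∈ P.codes k v := by
  induction k generalizing v with
  | zero => simp [code, codes]
  | succ k ih => exact Finset.mem_image_of_mem _ (map_filter_mem_forest ih)

/-- The largest depth of a vertex. -/
noncomputable def height : ℕ := Finset.univ.sup P.depth

lemma depth_le_height (v : V) : P.depth v ≤ P.height :=
  Finset.le_sup (f := P.depth) (Finset.mem_univ v)

open Classical in
lemma sum_size (k : ℕ) (hk : k ≤ P.height) :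
    ∑ v with P.depth v + k = P.height, P.size k v =
      (Finset.univ.filter fun w => P.height ≤ P.depth w + k).card := by
  induction k with
  | zero =>
    simp only [size, Finset.sum_const, smul_eq_mul, mul_one, add_zero]
    congr 1
    ext v
    have := P.depth_le_height v
    simp only [Finset.mem_filter, Finset.mem_univ, true_and]
    omega
  | succ k ih =>
    have hfib : ∑ v with P.depth v + (k + 1) = P.height, ∑ w ∈ P.children v, P.size k w =
        ∑ w with P.depth w + k = P.height, P.size k w := by
      refine Eq.trans ?_ (Finset.sum_fiberwise_of_maps_to (g := P.par)
        (t := Finset.univ.filter fun v => P.depth v + (k + 1) = P.height) ?_ _)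
      · refine Finset.sum_congr rfl fun v hv => Finset.sum_congr ?_ fun _ _ => rfl
        ext w
        simp only [Finset.mem_filter, Finset.mem_univ, true_and] at hv
        simp only [mem_children, Finset.mem_filter, Finset.mem_univ, true_and]
        refine and_congr_left fun hw => ⟨fun h => ?_, fun h h' => ?_⟩
        · have := P.depth_par w h
          rw [hw] at this
          omega
        · rw [h', P.depth_root] at h
          omega
      · intro w hw
        simp only [Finset.mem_filter, Finset.mem_univ, true_and] at hw ⊢
        have := P.depth_par w fun h => by
          rw [h, P.depth_root] at hw
          omega
        omega
    simp only [size, Finset.sum_add_distrib]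
    rw [hfib, ih (by omega), ← Finset.card_eq_sum_ones, ← Finset.card_union_of_disjoint]
    · congr 1
      ext w
      simp only [Finset.mem_filter, Finset.mem_univ, true_and, Finset.mem_union]
      omega
    · rw [Finset.disjoint_filter]
      intro w _ _
      omega

lemma size_height : P.size P.height r = Fintype.card V := by
  classical
  have h := P.sum_size P.height le_rfl
  have hr : (Finset.univ.filter fun v => P.depth v + P.height = P.height) = {r} := by
    ext v
    simp [P.depth_eq_zero]
  rw [hr, Finset.sum_singleton] at h
  rw [h, ← Finset.card_univ]
  congr 1
  ext
  simp

/-- The maps that transport the coded structure of `S` to that of `T`, up to depth `d`. -/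
structure Transports (S T : Set V) (F : V → V) (d : ℕ) : Prop where
  root : F r = r
  mem : ∀ w ∈ S, P.depth w ≤ d → F w ∈ T
  depth : ∀ w ∈ S, P.depth w ≤ d → P.depth (F w) = P.depth w
  code : ∀ w ∈ S, P.depth w ≤ d →
    P.code T (P.height - P.depth w) (F w) = P.code S (P.height - P.depth w) w
  par : ∀ w ∈ S, P.depth w ≤ d → w ≠ r → P.par (F w) = F (P.par w)
  inj : ∀ u ∈ S, ∀ v ∈ S, P.depth u ≤ d → P.depth v ≤ d → F u = F v → u = v

variable {P}

lemma exists_transports {S T : Set V} (hS : P.Closed S) (hT : P.Closed T)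
    (h : P.code S P.height r = P.code T P.height r) (d : ℕ) : ∃ F, P.Transports S T F d := by
  classical
  induction d with
  | zero =>
    refine ⟨id, rfl, fun w hw h0 => ?_, fun w hw h0 => rfl, fun w hw h0 => ?_, fun _ _ _ _ => rfl,
      fun _ _ _ _ _ _ h => h⟩ <;> obtain rfl := P.depth_eq_zero.1 (Nat.le_zero.1 h0)
    · exact hT.1
    · simpa [P.depth_root] using h.symm
  | succ d ih =>
    obtain ⟨F, hF⟩ := ih
    have hmatch : ∀ v, ∃ e : V → V, v ∈ S → P.depth v = d → d < P.height →
        (∀ w ∈ (P.children v).filter (· ∈ S), e w ∈ (P.children (F v)).filter (· ∈ T) ∧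
          P.code T (P.height - (d + 1)) (e w) = P.code S (P.height - (d + 1)) w) ∧
        Set.InjOn e ((P.children v).filter (· ∈ S)) := by
      intro v
      by_cases hv : v ∈ S ∧ P.depth v = d ∧ d < P.height
      · obtain ⟨hvS, hvd, hd⟩ := hv
        have hc := hF.code v hvS hvd.le
        rw [hvd, show P.height - d = P.height - (d + 1) + 1 by omega] at hc
        obtain ⟨e, he⟩ := exists_injOn_of_map_eq (Encodable.encode_injective hc).symm r
        exact ⟨e, fun _ _ _ => he⟩
      · exact ⟨id, fun h1 h2 h3 => absurd ⟨h1, h2, h3⟩ hv⟩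
    choose e he using hmatch
    have key : ∀ w ∈ S, P.depth w = d + 1 → w ≠ r ∧ P.par w ∈ S ∧ P.depth (P.par w) = d ∧
        d < P.height := by
      intro w hw hwd
      have hwr : w ≠ r := fun h => by rw [h, P.depth_root] at hwd; omega
      have := P.depth_par w hwr
      have := P.depth_le_height w
      exact ⟨hwr, hS.2 w hw hwr, by omega, by omega⟩
    have keye : ∀ w ∈ S, P.depth w = d + 1 → e (P.par w) w ∈ T ∧ e (P.par w) w ≠ r ∧
        P.par (e (P.par w) w) = F (P.par w) ∧ P.depth (e (P.par w) w) = d + 1 ∧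
        P.code T (P.height - (d + 1)) (e (P.par w) w) = P.code S (P.height - (d + 1)) w := by
      intro w hw hwd
      obtain ⟨hwr, hp, hpd, hd⟩ := key w hw hwd
      have := (he _ hp hpd hd).1 w (by simp [mem_children, hwr, hw])
      simp only [Finset.mem_filter, mem_children] at this
      obtain ⟨⟨⟨h1, h2⟩, h3⟩, h4⟩ := this
      refine ⟨h3, h1, h2, ?_, h4⟩
      rw [← P.depth_par _ h1, h2, hF.depth _ hp hpd.le, hpd]
    have hsplit {w : V} (hwd : P.depth w ≤ d + 1) (hw : ¬ P.depth w ≤ d) : P.depth w = d + 1 := by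
      omega
    have hpar {w : V} (hwr : w ≠ r) (hwd : P.depth w ≤ d + 1) : P.depth (P.par w) ≤ d := by
      have := P.depth_par w hwr
      omega
    refine ⟨fun w => if P.depth w ≤ d then F w else e (P.par w) w, ?_, fun w hw hwd => ?_,
      fun w hw hwd => ?_, fun w hw hwd => ?_, fun w hw hwd hwr => ?_,
      fun u hu v hv hud hvd huv => ?_⟩
    · simp [P.depth_root, hF.root]
    · split_ifs with hd
      · exact hF.mem w hw hd
      · exact (keye w hw (hsplit hwd hd)).1
    · split_ifs with hd
      · exact hF.depth w hw hd
      · rw [(keye w hw (hsplit hwd hd)).2.2.2.1, hsplit hwd hd]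
    · split_ifs with hd
      · exact hF.code w hw hd
      · rw [hsplit hwd hd, (keye w hw (hsplit hwd hd)).2.2.2.2]
    · rw [if_pos (hpar hwr hwd)]
      split_ifs with hd
      · exact hF.par w hw hd hwr
      · exact (keye w hw (hsplit hwd hd)).2.2.1
    · split_ifs at huv with h1 h2 h2
      · exact hF.inj u hu v hv h1 h2 huv
      · have := (keye v hv (hsplit hvd h2)).2.2.2.1
        rw [← huv, hF.depth u hu h1] at this
        omega
      · have := (keye u hu (hsplit hud h1)).2.2.2.1
        rw [huv, hF.depth v hv h2] at this
        omega
      · have hu' := keye u hu (hsplit hud h1)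
        have hv' := keye v hv (hsplit hvd h2)
        obtain ⟨hur, hup, hupd, hd⟩ := key u hu (hsplit hud h1)
        obtain ⟨hvr, hvp, hvpd, -⟩ := key v hv (hsplit hvd h2)
        have hpp : P.par u = P.par v :=
          hF.inj _ hup _ hvp hupd.le hvpd.le (by rw [← hu'.2.2.1, ← hv'.2.2.1, huv])
        rw [hpp] at huv
        exact (he _ hvp hvpd hd).2 (by simp [mem_children, hur, hu, hpp])
          (by simp [mem_children, hvr, hv]) huv

lemma exists_iso {G : SimpleGraph V}
    (hG : ∀ u v, G.Adj u v ↔ (u ≠ r ∧ P.par u = v) ∨ (v ≠ r ∧ P.par v = u))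
    {S T : Set V} (hS : P.Closed S) (hT : P.Closed T)
    (h : P.code S P.height r = P.code T P.height r) :
    ∃ f : G.induce S ≃g G.induce T, f ⟨r, hS.1⟩ = ⟨r, hT.1⟩ := by
  obtain ⟨F, hF⟩ := exists_transports hS hT h P.height
  obtain ⟨F', hF'⟩ := exists_transports hT hS h.symm P.height
  let f : S → T := fun w => ⟨F w, hF.mem w w.2 (P.depth_le_height _)⟩
  let f' : T → S := fun w => ⟨F' w, hF'.mem w w.2 (P.depth_le_height _)⟩
  have hf : Function.Injective f := fun u v huv => Subtype.ext <|
    hF.inj u u.2 v v.2 (P.depth_le_height _) (P.depth_le_height _) (congrArg Subtype.val huv)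
  have hf' : Function.Injective f' := fun u v huv => Subtype.ext <|
    hF'.inj u u.2 v v.2 (P.depth_le_height _) (P.depth_le_height _) (congrArg Subtype.val huv)
  have hbij := hf.bijective_of_nat_card_le (Nat.card_le_card_of_injective f' hf')
  have hroot (u : S) : F u ≠ r ↔ (u : V) ≠ r := by
    rw [Ne, ← P.depth_eq_zero, hF.depth u u.2 (P.depth_le_height _), P.depth_eq_zero]
  have hpar (u v : S) (hu : (u : V) ≠ r) : P.par (F u) = F v ↔ P.par u = v := by
    rw [hF.par u u.2 (P.depth_le_height _) hu]
    exact ⟨hF.inj _ (hS.2 u u.2 hu) v v.2 (P.depth_le_height _) (P.depth_le_height _),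
      congrArg F⟩
  refine ⟨⟨Equiv.ofBijective f hbij, fun {u v} => ?_⟩, Subtype.ext hF.root⟩
  simp only [Equiv.ofBijective_apply, SimpleGraph.comap_adj, Function.Embedding.subtype_apply, hG,
    f, hroot]
  exact or_congr (and_congr_right (hpar u v)) (and_congr_right (hpar v u))

end ParentMap

lemma SimpleGraph.Connected.exists_adj_dist_add_one {V : Type*} {G : SimpleGraph V}
    (hG : G.Connected) {r w : V} (hw : w ≠ r) : ∃ v, G.Adj w v ∧ G.dist r v + 1 = G.dist r w := by
  obtain ⟨p, hp⟩ := hG.exists_walk_length_eq_dist w r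
  cases p with
  | nil => exact absurd rfl hw
  | @cons _ v _ h p =>
    refine ⟨v, h, ?_⟩
    have h1 := dist_le p
    have h2 := hG.dist_triangle (u := r) (v := v) (w := w)
    rw [dist_comm] at h1 hp
    rw [dist_eq_one_iff_adj.2 h.symm] at h2
    rw [Walk.length_cons] at hp
    omega

lemma SimpleGraph.IsTree.exists_parentMap {V : Type*} [Fintype V] {G : SimpleGraph V}
    (hG : G.IsTree) (r : V) : ∃ P : ParentMap r,
      ∀ u v, G.Adj u v ↔ (u ≠ r ∧ P.par u = v) ∨ (v ≠ r ∧ P.par v = u) := by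
  classical
  have h : ∀ w, ∃ v, (w = r → v = r) ∧ (w ≠ r → G.Adj w v ∧ G.dist r v + 1 = G.dist r w) := by
    intro w
    by_cases hw : w = r
    · exact ⟨r, fun _ => rfl, fun h => absurd hw h⟩
    · obtain ⟨v, hv⟩ := hG.connected.exists_adj_dist_add_one hw
      exact ⟨v, fun h => absurd h hw, fun _ => hv⟩
  choose par hroot hpar using h
  refine ⟨⟨par, G.dist r, hroot r rfl, dist_self, fun w hw => (hpar w hw).2⟩, fun u v => ⟨?_, ?_⟩⟩
  · intro huv
    have hsurj := Finset.surjOn_of_injOn_of_card_le (s := Finset.univ.erase r)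
      (t := G.edgeFinset) (fun w => s(w, par w))
      (fun w hw => by simpa using (hpar w (by simpa using hw)).1)
      (fun u hu v hv huv => by
        have hu := (hpar u (by simpa using hu)).2
        have hv := (hpar v (by simpa using hv)).2
        rcases Sym2.eq_iff.1 huv with ⟨h, -⟩ | ⟨h1, h2⟩
        · exact h
        · rw [h2] at hu
          rw [← h1] at hv
          omega)
      (by
        rw [Finset.card_erase_of_mem (Finset.mem_univ r), Finset.card_univ,
          ← hG.card_edgeFinset, Nat.add_sub_cancel])
    obtain ⟨w, hw, hwe⟩ := hsurj (show s(u, v) ∈ (G.edgeFinset : Set (Sym2 V)) by simpa using huv)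
    have hw : w ≠ r := by simpa using hw
    rcases Sym2.eq_iff.1 hwe with ⟨rfl, h⟩ | ⟨rfl, h⟩
    · exact Or.inl ⟨hw, h⟩
    · exact Or.inr ⟨hw, h⟩
  · rintro (⟨hu, rfl⟩ | ⟨hv, rfl⟩)
    · exact (hpar u hu).1
    · exact (hpar v hv).1.symm

lemma ParentMap.closed_of_connected {V : Type*} {G : SimpleGraph V} {r : V} {P : ParentMap r}
    (hG : ∀ u v, G.Adj u v ↔ (u ≠ r ∧ P.par u = v) ∨ (v ≠ r ∧ P.par v = u))
    {S : Set V} (hr : r ∈ S) (hS : (G.induce S).Connected) : P.Closed S := by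
  refine ⟨hr, fun w hw hwr => ?_⟩
  by_contra hp
  have hwalk : ∀ (u v : S), (G.induce S).Walk u v → (∃ k, P.par^[k] u = w) →
      ∃ k, P.par^[k] v = w := by
    intro u v p
    induction p with
    | nil => exact id
    | @cons u v _ h _ ih =>
      rintro ⟨k, hk⟩
      refine ih ?_
      rcases (hG u v).1 h with ⟨-, huv⟩ | ⟨-, hvu⟩
      · cases k with
        | zero =>
          rw [Function.iterate_zero_apply] at hk
          rw [← hk, huv] at hp
          exact absurd v.2 hp
        | succ k => exact ⟨k, by rwa [Function.iterate_succ_apply, huv] at hk⟩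
      · exact ⟨k + 1, by rwa [Function.iterate_succ_apply, hvu]⟩
  obtain ⟨p⟩ := hS.preconnected ⟨w, hw⟩ ⟨r, hr⟩
  obtain ⟨k, hk⟩ := hwalk _ _ p ⟨0, rfl⟩
  rw [Function.iterate_fixed P.par_root] at hk
  exact hwr hk.symm

theorem nr_pow_le {V : Type*} [Fintype V] {G : SimpleGraph V} (hG : G.IsTree) (r : V) :
    nr G r ^ 4 ≤ 5 ^ Fintype.card V := by
  obtain ⟨P, hP⟩ := hG.exists_parentMap r
  have hA := (P.codeSet_codes P.height r).card_pow_le.1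
  rw [P.size_height] at hA
  refine (Nat.pow_le_pow_left ?_ 4).trans hA
  let f : Quot (RootedSubtreeIso G r) → P.codes P.height r := fun q =>
    ⟨P.code q.out.1 P.height r, P.code_mem_codes _ _ _⟩
  have hf : Function.Injective f := fun q q' h => by
    rw [← Quot.out_eq q, ← Quot.out_eq q']
    exact Quot.sound <| ParentMap.exists_iso hP
      (ParentMap.closed_of_connected hP q.out.2.1 q.out.2.2)
      (ParentMap.closed_of_connected hP q'.out.2.1 q'.out.2.2) (congrArg Subtype.val h)
  simpa [nr] using Nat.card_le_card_of_injective f hf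

/-- The root with two children, one of which has a further child. -/
def fiveTree : SimpleGraph (Fin 4) where
  Adj u v := s(u, v) ∈ ({s(0, 1), s(0, 2), s(1, 3)} : Finset (Sym2 (Fin 4)))
  symm := ⟨fun u v h => by rwa [Sym2.eq_swap (a := v)]⟩
  loopless := ⟨by decide⟩

instance : DecidableRel fiveTree.Adj := fun u v =>
  inferInstanceAs (Decidable (s(u, v) ∈ ({s(0, 1), s(0, 2), s(1, 3)} : Finset (Sym2 (Fin 4)))))

lemma fiveTree_induce_connected {S : Set (Fin 4)} (h0 : 0 ∈ S) (h : 3 ∈ S → 1 ∈ S) :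
    (fiveTree.induce S).Connected := by
  have hadj {u v : Fin 4} (hu : u ∈ S) (hv : v ∈ S) (huv : fiveTree.Adj u v) :
      (fiveTree.induce S).Reachable ⟨u, hu⟩ ⟨v, hv⟩ :=
    SimpleGraph.Adj.reachable (by simpa using huv)
  refine SimpleGraph.connected_iff_exists_forall_reachable _ |>.2 ⟨⟨0, h0⟩, ?_⟩
  rintro ⟨w, hw⟩
  fin_cases w
  · exact Reachable.refl _
  · exact hadj h0 hw (by decide)
  · exact hadj h0 hw (by decide)
  · exact (hadj h0 (h hw) (by decide)).trans (hadj (h hw) hw (by decide))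

lemma fiveTree_isTree : fiveTree.IsTree := by
  refine isTree_iff_connected_and_card.2 ⟨?_, ?_⟩
  · exact (induceUnivIso fiveTree).connected_iff.1
      (fiveTree_induce_connected (Set.mem_univ _) fun _ => Set.mem_univ _)
  · rw [Nat.card_eq_fintype_card, Nat.card_eq_fintype_card]
    decide

/-- Representatives of the root subtrees of `fiveTree`. -/
def fiveSubtree : Fin 5 → Finset (Fin 4) :=
  ![{0}, {0, 1}, {0, 1, 2}, {0, 1, 3}, {0, 1, 2, 3}]

lemma five_le_nr_fiveTree : 5 ≤ nr fiveTree 0 := by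
  let S : Fin 5 → RootedSubtree fiveTree 0 := fun i =>
    ⟨{w | w ∈ fiveSubtree i}, by revert i; decide,
      fiveTree_induce_connected (by revert i; decide) (by revert i; decide)⟩
  let inv : RootedSubtree fiveTree 0 → ℕ × ℕ := fun T =>
    (Nat.card T.1, Nat.card {w : T.1 // (fiveTree.induce T.1).Adj ⟨0, T.2.1⟩ w})
  have hinv : ∀ T T', RootedSubtreeIso fiveTree 0 T T' → inv T = inv T' := by
    rintro T T' ⟨f, hf⟩
    refine Prod.ext (Nat.card_congr f.toEquiv) (Nat.card_congr (f.toEquiv.subtypeEquiv fun w => ?_))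
    rw [← hf]
    exact f.map_adj_iff.symm
  have hval : ∀ i, inv (S i) = (![(1, 0), (2, 1), (3, 2), (3, 1), (4, 2)] : Fin 5 → ℕ × ℕ) i := by
    intro i
    have h1 : Nat.card (S i).1 = (fiveSubtree i).card := by simp [S]
    have h2 : Nat.card {w : (S i).1 // (fiveTree.induce (S i).1).Adj ⟨0, (S i).2.1⟩ w} =
        ((fiveSubtree i).filter (fiveTree.Adj 0)).card := by
      refine (Nat.card_congr (Equiv.subtypeSubtypeEquivSubtypeInter
        (· ∈ fiveSubtree i) (fiveTree.Adj 0))).trans ?_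
      rw [Nat.card_eq_fintype_card, Fintype.card_subtype]
      clear h1
      revert i
      decide
    simp only [inv, h1, h2]
    clear h1 h2
    revert i
    decide
  have hinj : Function.Injective fun i => Quot.mk (RootedSubtreeIso fiveTree 0) (S i) := by
    intro i j hij
    have : inv (S i) = inv (S j) := congrArg (Quot.lift inv hinv) hij
    rw [hval, hval] at this
    clear hij
    revert i j
    decide
  have : Finite (RootedSubtree fiveTree 0) := Subtype.finite
  simpa [nr] using Nat.card_le_card_of_injective _ hinj

lemma nr_le_five {G : SimpleGraph (Fin 4)} (hG : G.IsTree) (r : Fin 4) : nr G r ≤ 5 := by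
  have := nr_pow_le hG r
  rw [Fintype.card_fin] at this
  exact (Nat.pow_le_pow_iff_left four_ne_zero).1 this

/-- There is a rooted tree `E₅` with `4` vertices and `nr E₅ = 5`; consequently
`R_4 = 5`, and `5^(1/4)` is the maximum of `nr T ^ (1/|T|)` over all rooted
trees `T`. -/
theorem exists_E5_and_max :
    (∃ (G : SimpleGraph (Fin 4)) (r : Fin 4), G.IsTree ∧ nr G r = 5) ∧
    maxNR 4 = 5 ∧
    ∀ (V : Type) [Fintype V] (G : SimpleGraph V) (r : V), G.IsTree →
      (nr G r : ℝ) ^ (1 / (Fintype.card V : ℝ)) ≤ (5 : ℝ) ^ ((1 : ℝ) / 4) := by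
  have h5 : nr fiveTree 0 = 5 := (nr_le_five fiveTree_isTree 0).antisymm five_le_nr_fiveTree
  refine ⟨⟨fiveTree, 0, fiveTree_isTree, h5⟩, IsGreatest.csSup_eq ⟨?_, ?_⟩, ?_⟩
  · exact ⟨fiveTree, 0, fiveTree_isTree, h5⟩
  · rintro k ⟨G, r, hG, rfl⟩
    exact nr_le_five hG r
  · intro V _ G r hG
    have hn : (0 : ℝ) < Fintype.card V := Nat.cast_pos.2 (Fintype.card_pos_iff.2 ⟨r⟩)
    have h : (nr G r : ℝ) ^ 4 ≤ 5 ^ Fintype.card V := by exact_mod_cast nr_pow_le hG r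
    have h0 : (0 : ℝ) ≤ nr G r := Nat.cast_nonneg _
    have h := Real.rpow_le_rpow (by positivity) h
      (show 0 ≤ 1 / (4 * (Fintype.card V : ℝ)) by positivity)
    rw [← Real.rpow_natCast, ← Real.rpow_natCast, ← Real.rpow_mul h0,
      ← Real.rpow_mul (by norm_num)] at h
    convert h using 2 <;> push_cast <;> field_simp
end
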